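/- The minimum number of vertices of a simple graph whose set of vertex degrees is exactly {6, 7} and whose girth is 5 equals 43; that is, there exists a graph with degree set {6,7}, girth 5 and 43 vertices, and every graph with degree set {6,7} and girth 5 has at least 43 vertices. -/

import Mathlib

open SimpleGraph

/-- Degree of a vertex, as the cardinality of its neighbour set. -/
noncomputable def ndeg {V : Type} (G : SimpleGraph V) (v : V) : ℕ :=
  (G.neighborSet v).ncard

/-- The degree set of a graph: the set of degrees of its vertices. -/
def degreeSet' {V : Type} (G : SimpleGraph V) : Set ℕ :=
  {d | ∃ v, ndeg G v = d}

/-- The set of orders of finite graphs with degree set exactly `D` and girth `5`. -/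
def cageOrders (D : Set ℕ) : Set ℕ :=
  {n | ∃ (V : Type) (G : SimpleGraph V), Finite V ∧ Nat.card V = n ∧
        G.egirth = 5 ∧ degreeSet' G = D}

theorem five_le_egirth_iff {V : Type} (G : SimpleGraph V) :
    5 ≤ G.egirth ↔ (∀ a b c, G.Adj a b → G.Adj b c → ¬ G.Adj c a) ∧
      ∀ a b c d, G.Adj a b → G.Adj b c → G.Adj c d → G.Adj d a → a = c ∨ b = d := by
  rw [le_egirth]
  refine ⟨fun h ↦ ⟨fun a b c hab hbc hca ↦ ?_, fun a b c d hab hbc hcd hda ↦ ?_⟩, ?_⟩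
  · have := h a (.cons hab (.cons hbc (.cons hca .nil))) (by
      have := hab.ne; have := hbc.ne; have := hca.ne
      simp [Walk.isCycle_def, Walk.isTrail_def]
      grind)
    simp at this
    exact absurd this (by decide)
  · by_contra! hne
    have := h a (.cons hab (.cons hbc (.cons hcd (.cons hda .nil)))) (by
      have := hab.ne; have := hbc.ne; have := hcd.ne; have := hda.ne
      simp [Walk.isCycle_def, Walk.isTrail_def]
      grind)
    simp at this
    exact absurd this (by decide)
  · rintro ⟨h3, h4⟩ a w hw
    match w, hw with
    | .nil, hw => simp at hw
    | .cons h1 .nil, _ => exact absurd h1 (by simp)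
    | .cons h1 (.cons h2 .nil), hw => exact absurd hw.three_le_length (by simp)
    | .cons h1 (.cons h2 (.cons h3' .nil)), hw => exact absurd h3' (h3 _ _ _ h1 h2)
    | .cons h1 (.cons h2 (.cons h3' (.cons h4' .nil))), hw =>
      have := h4 _ _ _ _ h1 h2 h3' h4'
      simp [Walk.isCycle_def] at hw
      grind
    | .cons h1 (.cons h2 (.cons h3' (.cons h4' (.cons h5 p)))), hw =>
      simp only [Walk.length_cons]
      norm_cast
      omega

/-- The Moore-type bound for girth at least five. -/
theorem card_ge_of_five_le_egirth {V : Type} [Finite V] (G : SimpleGraph V) (hG : 5 ≤ G.egirth)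
    (v : V) (k : ℕ) (hk : ∀ u, k + 1 ≤ ndeg G u) :
    1 + ndeg G v + ndeg G v * k ≤ Nat.card V := by
  classical
  have := Fintype.ofFinite V
  obtain ⟨h3, h4⟩ := (five_le_egirth_iff G).1 hG
  have hdeg (u : V) : ndeg G u = (G.neighborFinset u).card := by
    rw [ndeg, Set.ncard_eq_toFinset_card', neighborFinset]
  have hdisj : ((G.neighborFinset v : Finset V) : Set V).PairwiseDisjoint
      (fun u ↦ (G.neighborFinset u).erase v) := by
    intro a ha b hb hab
    rw [Function.onFun, Finset.disjoint_left]
    intro x hx hy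
    simp at ha hb hx hy
    have := h4 v a x b ha hx.2 hy.2.symm hb.symm
    grind
  have hcard : ndeg G v * k ≤
      ((G.neighborFinset v).biUnion fun u ↦ (G.neighborFinset u).erase v).card := by
    rw [Finset.card_biUnion hdisj, hdeg v, ← smul_eq_mul]
    refine Finset.card_nsmul_le_sum _ _ _ fun u hu ↦ ?_
    have hv : v ∈ G.neighborFinset u := by simpa [adj_comm] using hu
    have := hk u
    rw [hdeg] at this
    rw [Finset.card_erase_of_mem hv]
    omega
  have hdisj' : Disjoint (G.neighborFinset v)
      ((G.neighborFinset v).biUnion fun u ↦ (G.neighborFinset u).erase v) := by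
    rw [Finset.disjoint_left]
    intro x hx hy
    simp at hx hy
    obtain ⟨u, hu, -, hux⟩ := hy
    exact h3 v u x hu hux hx.symm
  have hnot : v ∉ (G.neighborFinset v) ∪
      ((G.neighborFinset v).biUnion fun u ↦ (G.neighborFinset u).erase v) := by
    simp
  have := Finset.card_le_univ (insert v ((G.neighborFinset v) ∪
      ((G.neighborFinset v).biUnion fun u ↦ (G.neighborFinset u).erase v)))
  rw [Finset.card_insert_of_notMem hnot, Finset.card_union_of_disjoint hdisj', ← hdeg] at this
  rw [Nat.card_eq_fintype_card]
  omega

/-- Robertson's pentagons and pentagrams: `inl (h, j)` is vertex `j` of the pentagon `h`,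
`inr (i, k)` is vertex `k` of the pentagram `i`. -/
abbrev RobertsonVertex : Type := ZMod 5 × ZMod 5 ⊕ ZMod 5 × ZMod 5

/-- Adjacency in the Hoffman–Singleton graph. -/
def robertsonAdj : RobertsonVertex → RobertsonVertex → Bool
  | .inl (h, j), .inl (h', j') => h = h' ∧ (j' = j + 1 ∨ j = j' + 1)
  | .inr (i, k), .inr (i', k') => i = i' ∧ (k' = k + 2 ∨ k = k' + 2)
  | .inl (h, j), .inr (i, k) => k = h * i + j
  | .inr (i, k), .inl (h, j) => k = h * i + j

/-- The Hoffman–Singleton graph. -/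
def hoffmanSingleton : SimpleGraph RobertsonVertex where
  Adj a b := robertsonAdj a b
  symm := ⟨by
    rintro (⟨h, j⟩ | ⟨h, j⟩) (⟨i, k⟩ | ⟨i, k⟩) <;> simp [robertsonAdj] <;> grind⟩
  loopless := ⟨by
    rintro (⟨h, j⟩ | ⟨h, j⟩) <;> simp [robertsonAdj] <;> decide⟩

instance : DecidableRel hoffmanSingleton.Adj := fun a b ↦
  inferInstanceAs (Decidable (robertsonAdj a b = true))

theorem hoffmanSingleton_five_le_egirth : 5 ≤ hoffmanSingleton.egirth := by
  have : Fact (Nat.Prime 5) := ⟨by norm_num⟩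
  rw [five_le_egirth_iff]
  constructor
  · rintro (⟨a, a'⟩ | ⟨a, a'⟩) (⟨b, b'⟩ | ⟨b, b'⟩) (⟨c, c'⟩ | ⟨c, c'⟩) <;>
      simp [hoffmanSingleton, robertsonAdj] <;> grind
  · rintro (⟨a, a'⟩ | ⟨a, a'⟩) (⟨b, b'⟩ | ⟨b, b'⟩) (⟨c, c'⟩ | ⟨c, c'⟩) (⟨d, d'⟩ | ⟨d, d'⟩) <;>
      simp [hoffmanSingleton, robertsonAdj] <;> grind

/-- A vertex of the Hoffman–Singleton graph together with six of its seven neighbours. -/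
def deletedStar : Finset RobertsonVertex :=
  {.inl (0, 0), .inl (0, 1), .inl (0, 4), .inr (0, 0), .inr (1, 0), .inr (2, 0), .inr (3, 0)}

/-- The Hoffman–Singleton graph without the vertices of `deletedStar`. -/
abbrev prunedGraph : SimpleGraph {v // v ∉ deletedStar} :=
  hoffmanSingleton.comap Subtype.val

theorem prunedGraph_egirth : prunedGraph.egirth = 5 := by
  apply le_antisymm
  · let x (j : ZMod 5) : {v // v ∉ deletedStar} := ⟨.inl (1, j), by revert j; decide⟩
    have hx : Function.Injective x := fun i j hij ↦ by simpa [x] using hij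
    have h (j : ZMod 5) : prunedGraph.Adj (x j) (x (j + 1)) := by
      revert j; decide
    have hw := egirth_le_length (G := prunedGraph) (w := (.cons (h 0) (.cons (h 1) (.cons (h 2)
      (.cons (h 3) (.cons (h 4) .nil)))) : prunedGraph.Walk (x 0) (x 0))) (by
        simp [Walk.isCycle_def, Walk.isTrail_def, hx.eq_iff]
        and_intros <;> decide)
    simpa using hw
  · obtain ⟨h3, h4⟩ := (five_le_egirth_iff _).1 hoffmanSingleton_five_le_egirth
    rw [five_le_egirth_iff]
    refine ⟨fun a b c ↦ h3 a b c, fun a b c d hab hbc hcd hda ↦ ?_⟩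
    simpa [Subtype.ext_iff] using h4 a b c d hab hbc hcd hda

theorem prunedGraph_ndeg (v : {v // v ∉ deletedStar}) :
    ndeg prunedGraph v =
      (Finset.univ.filter fun w : RobertsonVertex ↦ w ∉ deletedStar ∧ robertsonAdj v w).card := by
  have : Subtype.val '' prunedGraph.neighborSet v =
      (Finset.univ.filter fun w : RobertsonVertex ↦ w ∉ deletedStar ∧ robertsonAdj v w) := by
    ext w
    simp [hoffmanSingleton, and_comm, -Sum.exists]
  rw [ndeg, ← Set.ncard_image_of_injective _ Subtype.val_injective, this, Set.ncard_coe_finset]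

theorem prunedGraph_degreeSet : degreeSet' prunedGraph = {6, 7} := by
  have key : ∀ v : RobertsonVertex, v ∉ deletedStar →
      (Finset.univ.filter fun w ↦ w ∉ deletedStar ∧ robertsonAdj v w).card = 6 ∨
      (Finset.univ.filter fun w ↦ w ∉ deletedStar ∧ robertsonAdj v w).card = 7 := by
    decide +kernel
  apply Set.Subset.antisymm
  · rintro d ⟨v, rfl⟩
    rw [prunedGraph_ndeg]
    exact key v v.2
  · rintro d (rfl | rfl)
    · exact ⟨⟨.inl (0, 2), by decide⟩, by rw [prunedGraph_ndeg]; decide +kernel⟩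
    · exact ⟨⟨.inr (4, 2), by decide⟩, by rw [prunedGraph_ndeg]; decide +kernel⟩

/-- the minimum order of a graph with degree set exactly {6,7} and girth 5
equals 43. -/
theorem stmt18 : IsLeast (cageOrders {6, 7}) 43 := by
  refine ⟨⟨_, prunedGraph, inferInstance, ?_, prunedGraph_egirth, prunedGraph_degreeSet⟩, ?_⟩
  · rw [Nat.card_eq_fintype_card]
    decide +kernel
  · rintro n ⟨V, G, _, rfl, hg, hd⟩
    obtain ⟨v, hv⟩ : 7 ∈ degreeSet' G := by simp [hd]
    have hk (u : V) : 5 + 1 ≤ ndeg G u := by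
      have : ndeg G u ∈ degreeSet' G := ⟨u, rfl⟩
      rw [hd] at this
      rcases this with h | h <;> simp_all
    have := card_ge_of_five_le_egirth G hg.ge v 5 hk
    omega
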